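/- arXiv:2201.07373 — 7 statements merged into one kernel-verified Lean document; each statement's English description precedes it below -/
import Mathlib

section
/- There is a passage (functor) from lax sound logics to databases: the assignment sending each lax sound logic L to its associated database and each lax sound logic morphism (𝐑, κ, φ̀, f, g) : L₂ ⇌ L₁ to the associated database morphism (𝐑, κ̄, φ̀, f, g) : R₂ ← R₁ (with image key bridge κ̄ having components κ̄_{r₂}(t) = g ∘ t ∘ φ̀_{r₂}) preserves identities and composition, and hence defines a functor db̊ : Snd̊^op → Db from the opposite of the category of lax sound logics to the category of FOLE relational databases with constant type domains. -/
open CategoryTheory Opposite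

/-- A type domain (attribute classification) over a sort set `X`:
a set of data values together with a classification relation between
data values and sorts. -/
structure TypeDomain (X : Type) : Type 1 where
  Value : Type
  classify : Value → X → Prop

/-- An `X`-signature: an arity set together with a sort map. -/
structure Sig (X : Type) : Type 1 where
  arity : Type
  sortOf : arity → X

/-- A signature morphism `h : (I', s') → (I, s)`: a function on arities
preserving sorts, `s' = s ∘ h`. -/
structure SigMor {X : Type} (s' s : Sig X) : Type where
  toFun : s'.arity → s.arity
  cond : ∀ i, s'.sortOf i = s.sortOf (toFun i)

/-- The identity signature morphism. -/
def SigMor.id {X : Type} (s : Sig X) : SigMor s s :=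
  ⟨fun i => i, fun _ => rfl⟩

/-- Composition of signature morphisms. -/
def SigMor.comp {X : Type} {a b c : Sig X}
    (f : SigMor a b) (g : SigMor b c) : SigMor a c :=
  ⟨fun i => g.toFun (f.toFun i), fun i => (f.cond i).trans (g.cond _)⟩

/-- The category `List(X)` of `X`-signatures and signature morphisms. -/
instance sigCategory (X : Type) : Category (Sig X) where
  Hom s' s := SigMor s' s
  id s := SigMor.id s
  comp f g := SigMor.comp f g
  id_comp := by intros; rfl
  comp_id := by intros; rfl
  assoc := by intros; rfl

/-- The tuple set `tup_A(I, s) = Π_{i ∈ I} A_{s(i)}`. -/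
def tup {X : Type} (A : TypeDomain X) (s : Sig X) : Type :=
  { t : s.arity → A.Value // ∀ i, A.classify (t i) (s.sortOf i) }

/-- The tuple map `tup_A(h) : tup_A(I, s) → tup_A(I', s')`, `t ↦ t ∘ h`,
induced by a signature morphism `h : (I', s') → (I, s)`. -/
def tupMap {X : Type} (A : TypeDomain X) {s' s : Sig X} (h : SigMor s' s) :
    tup A s → tup A s' :=
  fun t => ⟨fun i => t.1 (h.toFun i), fun i => by rw [h.cond i]; exact t.2 _⟩

/-- An `A`-table: a signature, a key set and a tuple function. -/
structure Table {X : Type} (A : TypeDomain X) : Type 1 where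
  sig : Sig X
  Key : Type
  tuple : Key → tup A sig

/-- A table morphism `(h, k) : T' ← T`, regarded as a morphism from `T` to `T'`:
a signature morphism `h : T'.sig → T.sig` and a key function `k : T.Key → T'.Key`
with `t' ∘ k = tup_A(h) ∘ t`. -/
structure TableMor {X : Type} (A : TypeDomain X) (T T' : Table A) : Type where
  sigMor : SigMor T'.sig T.sig
  keyFun : T.Key → T'.Key
  cond : ∀ k, T'.tuple (keyFun k) = tupMap A sigMor (T.tuple k)

theorem TableMor.ext' {X : Type} {A : TypeDomain X} {T T' : Table A}
    {m m' : TableMor A T T'} (h1 : m.sigMor = m'.sigMor)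
    (h2 : m.keyFun = m'.keyFun) : m = m' := by
  cases m; cases m'; cases h1; cases h2; rfl

/-- The category `Tbl(A)` of `A`-tables. -/
instance tblCategory {X : Type} (A : TypeDomain X) : Category (Table A) where
  Hom T T' := TableMor A T T'
  id T := ⟨SigMor.id T.sig, fun k => k, fun _ => rfl⟩
  comp {T T' T''} f g :=
    ⟨SigMor.comp g.sigMor f.sigMor, fun k => g.keyFun (f.keyFun k), fun k => by
      show T''.tuple (g.keyFun (f.keyFun k)) = _
      rw [g.cond, f.cond]; rfl⟩
  id_comp := by intros; rfl
  comp_id := by intros; rfl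
  assoc := by intros; rfl

/-- An `A`-relation: a signature together with a subset of the tuple set. -/
structure Relation {X : Type} (A : TypeDomain X) : Type 1 where
  sig : Sig X
  rel : Set (tup A sig)

/-- A relation morphism `(I', s', R') ← (I, s, R)`, regarded as a morphism
from `R` to `R'`: a signature morphism under which `tup_A(h)` maps `R` into `R'`. -/
structure RelMor {X : Type} (A : TypeDomain X) (R R' : Relation A) : Type where
  sigMor : SigMor R'.sig R.sig
  cond : ∀ t ∈ R.rel, tupMap A sigMor t ∈ R'.rel

theorem RelMor.ext' {X : Type} {A : TypeDomain X} {R R' : Relation A}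
    {m m' : RelMor A R R'} (h1 : m.sigMor = m'.sigMor) : m = m' := by
  cases m; cases m'; cases h1; rfl

/-- The category `Rel(A)` of `A`-relations. -/
instance relCategory {X : Type} (A : TypeDomain X) : Category (Relation A) where
  Hom R R' := RelMor A R R'
  id R := ⟨SigMor.id R.sig, fun _ ht => ht⟩
  comp f g := ⟨SigMor.comp g.sigMor f.sigMor, fun t ht => g.cond _ (f.cond t ht)⟩
  id_comp := by intros; rfl
  comp_id := by intros; rfl
  assoc := by intros; rfl

/-- An `A`-relation viewed as the `A`-table whose key set is the relation
and whose tuple function is the subset inclusion. -/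
def Relation.toTable {X : Type} {A : TypeDomain X} (R : Relation A) : Table A :=
  ⟨R.sig, { t : tup A R.sig // t ∈ R.rel }, fun t => t.1⟩

/-- A schema: a set of predicate symbols together with a signature assignment. -/
structure Schema (X : Type) : Type 1 where
  Pred : Type
  sigOf : Pred → Sig X

/-- A lax `S`-structure with type domain `A`: key sets and tuple functions
indexed by the predicates. -/
structure LaxStructure {X : Type} (S : Schema X) (A : TypeDomain X) : Type 1 where
  Key : S.Pred → Type
  tuple : ∀ r, Key r → tup A (S.sigOf r)

/-- The table interpretation `T_M(r) = (σ(r), K(r), τ_r)`. -/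
def LaxStructure.tblInterp {X : Type} {S : Schema X} {A : TypeDomain X}
    (M : LaxStructure S A) (r : S.Pred) : Table A :=
  ⟨S.sigOf r, M.Key r, M.tuple r⟩

/-- The relation interpretation `R_M(r) = (σ(r), τ_r(K(r)))`. -/
def LaxStructure.relInterp {X : Type} {S : Schema X} {A : TypeDomain X}
    (M : LaxStructure S A) (r : S.Pred) : Relation A :=
  ⟨S.sigOf r, Set.range (M.tuple r)⟩

/-- An abstract `S`-specification: given a category of abstract constraints on
the predicate set, a functorial assignment of signature morphisms to abstract
constraints, agreeing with `σ` on objects. -/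
structure AbstractSpec {X : Type} (S : Schema X) [Category.{0} S.Pred] : Type 1 where
  smor : ∀ {r' r : S.Pred}, (r' ⟶ r) → SigMor (S.sigOf r') (S.sigOf r)
  smor_id : ∀ r : S.Pred, smor (𝟙 r) = SigMor.id (S.sigOf r)
  smor_comp : ∀ {a b c : S.Pred} (p : a ⟶ b) (q : b ⟶ c),
    smor (p ≫ q) = SigMor.comp (smor p) (smor q)

/-- A lax `S`-structure `M` satisfies an abstract specification `T` when, for
every abstract constraint `p : r' → r`, the direct image of `τ_r(K(r))` under
`tup_A(𝐒(p))` is contained in `τ_{r'}(K(r'))`. -/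
def Satisfies {X : Type} {S : Schema X} [Category.{0} S.Pred] {A : TypeDomain X}
    (M : LaxStructure S A) (T : AbstractSpec S) : Prop :=
  ∀ {r' r : S.Pred} (p : r' ⟶ r),
    tupMap A (T.smor p) '' Set.range (M.tuple r) ⊆ Set.range (M.tuple r')

/-- The induced `X₁`-signature `Σ_f(I, s) = (I, f ∘ s)` along a sort function. -/
def sigSigma {X₂ X₁ : Type} (f : X₂ → X₁) (s : Sig X₂) : Sig X₁ :=
  ⟨s.arity, fun i => f (s.sortOf i)⟩

/-- The tuple conversion map `τ̀_{(f,g)}(I, s) : tup_{A₁}(Σ_f(I, s)) → tup_{A₂}(I, s)`,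
`t ↦ g ∘ t`, along a type domain morphism `(f, g) : A₂ ⇌ A₁`. -/
def tupConv {X₂ X₁ : Type} (A₂ : TypeDomain X₂) (A₁ : TypeDomain X₁)
    (f : X₂ → X₁) (g : A₁.Value → A₂.Value)
    (info : ∀ y x, A₂.classify (g y) x ↔ A₁.classify y (f x)) (s : Sig X₂) :
    tup A₁ (sigSigma f s) → tup A₂ s :=
  fun t => ⟨fun i => g (t.1 i), fun i => (info _ _).mpr (t.2 i)⟩

/-! ### Bundled lax sound logics and relational databases -/

/-- A (bundled) lax sound logic `L = (S, M, T)`: a schema, an abstract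
specification (a category of abstract constraints on the predicates together
with a functorial signature-morphism assignment agreeing with `σ` on objects),
and a lax structure satisfying the specification. -/
structure BSoundLogic : Type 1 where
  X : Type
  A : TypeDomain X
  P : Type
  [cat : Category.{0} P]
  sigOf : P → Sig X
  smor : ∀ {r' r : P}, (r' ⟶ r) → SigMor (sigOf r') (sigOf r)
  smor_id : ∀ r : P, smor (𝟙 r) = SigMor.id (sigOf r)
  smor_comp : ∀ {a b c : P} (p : a ⟶ b) (q : b ⟶ c),
    smor (p ≫ q) = SigMor.comp (smor p) (smor q)
  Key : P → Type
  tuple : ∀ r, Key r → tup A (sigOf r)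
  sat : ∀ {r' r : P} (p : r' ⟶ r),
    tupMap A (smor p) '' Set.range (tuple r) ⊆ Set.range (tuple r')

attribute [instance] BSoundLogic.cat

/-- A (bundled) FOLE relational database with constant type domain
`R = (𝐑, 𝐓, A)`. -/
structure BDatabase : Type 1 where
  X : Type
  A : TypeDomain X
  P : Type
  [cat : Category.{0} P]
  T : Pᵒᵖ ⥤ Table A

attribute [instance] BDatabase.cat

/-- The data of a lax sound logic morphism `B ⇌ C`. -/
structure SndData (B C : BSoundLogic) : Type where
  RFun : B.P ⥤ C.P
  f : B.X → C.X
  g : C.A.Value → B.A.Value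
  info : ∀ y x, B.A.classify (g y) x ↔ C.A.classify y (f x)
  φ : ∀ r₂ : B.P, SigMor (sigSigma f (B.sigOf r₂)) (C.sigOf (RFun.obj r₂))
  φ_nat : ∀ {r'₂ r₂ : B.P} (p : r'₂ ⟶ r₂),
    (φ r₂).toFun ∘ (B.smor p).toFun
      = (C.smor (RFun.map p)).toFun ∘ (φ r'₂).toFun
  κ : ∀ r₂ : B.P, C.Key (RFun.obj r₂) → B.Key r₂
  tuple_cond : ∀ (r₂ : B.P) (k₁ : C.Key (RFun.obj r₂)),
    B.tuple r₂ (κ r₂ k₁)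
      = tupConv B.A C.A f g info (B.sigOf r₂)
          (tupMap C.A (φ r₂) (C.tuple (RFun.obj r₂) k₁))

/-- The data of a database morphism `B ← C`. -/
structure DbData (B C : BDatabase) : Type where
  RFun : B.P ⥤ C.P
  f : B.X → C.X
  g : C.A.Value → B.A.Value
  info : ∀ y x, B.A.classify (g y) x ↔ C.A.classify y (f x)
  φ : ∀ r₂ : B.P, SigMor (sigSigma f ((B.T.obj (Opposite.op r₂)).sig))
    ((C.T.obj (Opposite.op (RFun.obj r₂))).sig)
  φ_nat : ∀ {r'₂ r₂ : B.P} (p : r'₂ ⟶ r₂),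
    (φ r₂).toFun ∘ (TableMor.sigMor (B.T.map p.op)).toFun
      = (TableMor.sigMor (C.T.map (RFun.map p).op)).toFun ∘ (φ r'₂).toFun
  κ : ∀ r₂ : B.P, (C.T.obj (Opposite.op (RFun.obj r₂))).Key →
    (B.T.obj (Opposite.op r₂)).Key
  κ_nat : ∀ {r'₂ r₂ : B.P} (p : r'₂ ⟶ r₂) k,
    κ r'₂ (TableMor.keyFun (C.T.map (RFun.map p).op) k)
      = TableMor.keyFun (B.T.map p.op) (κ r₂ k)
  tuple_cond : ∀ (r₂ : B.P) k₁,
    (B.T.obj (Opposite.op r₂)).tuple (κ r₂ k₁)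
      = tupConv B.A C.A f g info ((B.T.obj (Opposite.op r₂)).sig)
          (tupMap C.A (φ r₂) ((C.T.obj (Opposite.op (RFun.obj r₂))).tuple k₁))

/-- The category `Snd̊` of lax sound logics: a morphism `L₂ ⟶ L₁` is
(the data of) a lax sound logic morphism `L₂ ⇌ L₁`. -/
instance sndCategory : Category.{0} BSoundLogic where
  Hom L₂ L₁ := SndData L₂ L₁
  id L :=
    { RFun := 𝟭 L.P
      f := fun x => x
      g := fun y => y
      info := fun _ _ => Iff.rfl
      φ := fun _ => ⟨fun i => i, fun _ => rfl⟩
      φ_nat := fun _ => rfl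
      κ := fun _ k => k
      tuple_cond := fun _ _ => rfl }
  comp {La Lb Lc} u v :=
    { RFun := u.RFun ⋙ v.RFun
      f := fun x => v.f (u.f x)
      g := fun y => u.g (v.g y)
      info := fun y x => (u.info (v.g y) x).trans (v.info y (u.f x))
      φ := fun r => ⟨fun i => (v.φ (u.RFun.obj r)).toFun ((u.φ r).toFun i),
        fun i => (congrArg v.f ((u.φ r).cond i)).trans
          ((v.φ (u.RFun.obj r)).cond ((u.φ r).toFun i))⟩
      φ_nat := by
        intro r' r p
        funext i
        exact (congrArg (v.φ (u.RFun.obj r)).toFun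
            (congrFun (u.φ_nat p) i)).trans
          (congrFun (v.φ_nat (u.RFun.map p)) ((u.φ r').toFun i))
      κ := fun r k => u.κ r (v.κ (u.RFun.obj r) k)
      tuple_cond := by
        intro r k
        show La.tuple r (u.κ r (v.κ (u.RFun.obj r) k)) = _
        rw [u.tuple_cond, v.tuple_cond]
        rfl }
  id_comp := by intros; rfl
  comp_id := by intros; rfl
  assoc := by intros; rfl

/-- The category `Db` of FOLE relational databases with constant type domains:
a morphism `D₁ ⟶ D₂` is (the data of) a database morphism `D₂ ← D₁`. -/
instance dbCategory : Category.{0} BDatabase where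
  Hom D₁ D₂ := DbData D₂ D₁
  id D :=
    { RFun := 𝟭 D.P
      f := fun x => x
      g := fun y => y
      info := fun _ _ => Iff.rfl
      φ := fun _ => ⟨fun i => i, fun _ => rfl⟩
      φ_nat := fun _ => rfl
      κ := fun _ k => k
      κ_nat := fun _ _ => rfl
      tuple_cond := fun _ _ => rfl }
  comp {D₁ D₂ D₃} u v :=
    { RFun := v.RFun ⋙ u.RFun
      f := fun x => u.f (v.f x)
      g := fun y => v.g (u.g y)
      info := fun y x => (v.info (u.g y) x).trans (u.info y (v.f x))
      φ := fun r => ⟨fun i => (u.φ (v.RFun.obj r)).toFun ((v.φ r).toFun i),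
        fun i => (congrArg u.f ((v.φ r).cond i)).trans
          ((u.φ (v.RFun.obj r)).cond ((v.φ r).toFun i))⟩
      φ_nat := by
        intro r' r p
        funext i
        exact (congrArg (u.φ (v.RFun.obj r)).toFun
            (congrFun (v.φ_nat p) i)).trans
          (congrFun (u.φ_nat (v.RFun.map p)) ((v.φ r').toFun i))
      κ := fun r k => v.κ r (u.κ (v.RFun.obj r) k)
      κ_nat := by
        intro r' r p k
        exact (congrArg (v.κ r') (u.κ_nat (v.RFun.map p) k)).trans
          (v.κ_nat p (u.κ (v.RFun.obj r) k))
      tuple_cond := by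
        intro r k
        show (D₃.T.obj (Opposite.op r)).tuple (v.κ r (u.κ (v.RFun.obj r) k)) = _
        rw [v.tuple_cond, u.tuple_cond]
        rfl }
  id_comp := by intros; rfl
  comp_id := by intros; rfl
  assoc := by intros; rfl

/-! ### The associated sound logic of a database and the associated database
of a sound logic -/

/-- The lax sound logic associated to a database `R = (𝐑, 𝐓, A)`: the schema
has predicate set the objects of `𝐑` with `σ(r) = 𝐒(r)`, the lax structure has
the key sets and tuple functions of the tables `𝐓(r)`, and the specification
is `(𝐑, 𝐒, X)`. -/
def sndOf (D : BDatabase) : BSoundLogic where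
  X := D.X
  A := D.A
  P := D.P
  cat := D.cat
  sigOf r := (D.T.obj (Opposite.op r)).sig
  smor p := TableMor.sigMor (D.T.map p.op)
  smor_id r := by
    show (D.T.map ((𝟙 r).op)).sigMor = SigMor.id _
    rw [show ((𝟙 r : r ⟶ r).op) = 𝟙 (Opposite.op r) from rfl, D.T.map_id]
    rfl
  smor_comp p q := by
    show (D.T.map ((p ≫ q).op)).sigMor
      = SigMor.comp (D.T.map p.op).sigMor (D.T.map q.op).sigMor
    rw [show ((p ≫ q).op) = q.op ≫ p.op from rfl, D.T.map_comp]
    rfl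
  Key r := (D.T.obj (Opposite.op r)).Key
  tuple r := (D.T.obj (Opposite.op r)).tuple
  sat := by
    intro r' r p x hx
    obtain ⟨s, ⟨k, rfl⟩, rfl⟩ := hx
    exact ⟨(D.T.map p.op).keyFun k, (D.T.map p.op).cond k⟩

/-- The key set of the associated database of a sound logic at a predicate:
the image relation `τ_r(K(r))`. -/
def imgKeyB (L : BSoundLogic) (r : L.P) : Type :=
  { t : tup L.A (L.sigOf r) // t ∈ Set.range (L.tuple r) }

/-- The database associated to a lax sound logic `L = (S, M, T)`: the table
interpretation functor sends each predicate to the relation interpretation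
`R_M(r)` (viewed as a table with key set `τ_r(K(r))` and inclusion tuple
function) and each abstract constraint to the relation morphism given by
`𝐒(p)`. -/
def dbOf (L : BSoundLogic) : BDatabase where
  X := L.X
  A := L.A
  P := L.P
  cat := L.cat
  T :=
    { obj := fun r => ⟨L.sigOf r.unop, imgKeyB L r.unop, fun t => t.1⟩
      map := fun {a b} q =>
        ⟨L.smor q.unop,
          fun t => ⟨tupMap L.A (L.smor q.unop) t.1,
            L.sat q.unop ⟨t.1, t.2, rfl⟩⟩,
          fun _ => rfl⟩
      map_id := by
        intro r
        apply TableMor.ext'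
        · exact L.smor_id r.unop
        · funext t
          apply Subtype.ext
          show tupMap L.A (L.smor (𝟙 r.unop)) t.1 = t.1
          rw [L.smor_id]
          rfl
      map_comp := by
        intro a b c q₁ q₂
        apply TableMor.ext'
        · show L.smor (q₂.unop ≫ q₁.unop)
            = SigMor.comp (L.smor q₂.unop) (L.smor q₁.unop)
          exact L.smor_comp q₂.unop q₁.unop
        · funext t
          apply Subtype.ext
          show tupMap L.A (L.smor (q₂.unop ≫ q₁.unop)) t.1
            = tupMap L.A (L.smor q₂.unop) (tupMap L.A (L.smor q₁.unop) t.1)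
          rw [L.smor_comp]
          rfl }

/-- The lax sound logic morphism associated to a database morphism: it has the
same components. -/
def sndDataOf {D' D : BDatabase} (m : DbData D' D) :
    sndOf D' ⟶ sndOf D :=
  ⟨m.RFun, m.f, m.g, m.info, m.φ, m.φ_nat, m.κ, m.tuple_cond⟩

/-- The database morphism associated to a lax sound logic morphism: the same
components, with the image key bridge `κ̄`, whose components are
`κ̄_{r₂}(t) = g ∘ t ∘ φ̀_{r₂}` on image relations. -/
noncomputable def dbDataOf {L' L : BSoundLogic} (m : SndData L' L) :
    dbOf L ⟶ dbOf L' where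
  RFun := m.RFun
  f := m.f
  g := m.g
  info := m.info
  φ := m.φ
  φ_nat := m.φ_nat
  κ := fun r₂ t =>
    ⟨tupConv L'.A L.A m.f m.g m.info (L'.sigOf r₂) (tupMap L.A (m.φ r₂) t.1),
      ⟨m.κ r₂ t.2.choose, by rw [m.tuple_cond, t.2.choose_spec]⟩⟩
  κ_nat := by
    intro r' r p t
    apply Subtype.ext
    apply Subtype.ext
    funext i
    exact (congrArg (fun j => m.g (t.1.1 j)) (congrFun (m.φ_nat p) i)).symm
  tuple_cond := fun _ _ => rfl

/-! ## Statement 1: the passage (functor) from lax sound logics to databases -/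

theorem sound_logic_to_database_passage :
    -- the assignment preserves identities ...
    (∀ L : BSoundLogic, dbDataOf (𝟙 L) = 𝟙 (dbOf L)) ∧
    -- ... and composition ...
    (∀ (L'' L' L : BSoundLogic) (m' : L'' ⟶ L') (m : L' ⟶ L),
      dbDataOf (m' ≫ m) = dbDataOf m ≫ dbDataOf m') ∧
    -- ... and hence defines a functor `db̊ : Snd̊ᵒᵖ ⥤ Db` sending each lax
    -- sound logic to its associated database and each lax sound logic
    -- morphism to the associated database morphism (with image key bridge
    -- `κ̄` having components `κ̄_{r₂}(t) = g ∘ t ∘ φ̀_{r₂}`)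
    (∃ F : BSoundLogicᵒᵖ ⥤ BDatabase,
      (∀ L : BSoundLogic, F.obj (Opposite.op L) = dbOf L) ∧
      (∀ (L' L : BSoundLogic) (m : L' ⟶ L), HEq (F.map m.op) (dbDataOf m))) := by
  have map_id : ∀ L : BSoundLogic, dbDataOf (𝟙 L) = 𝟙 (dbOf L) := fun _ => rfl
  have map_comp : ∀ (L'' L' L : BSoundLogic) (m' : L'' ⟶ L') (m : L' ⟶ L),
      dbDataOf (m' ≫ m) = dbDataOf m ≫ dbDataOf m' := fun _ _ _ _ _ => rfl
  exact ⟨map_id, map_comp,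
    { obj := fun L => dbOf L.unop
      map := fun m => dbDataOf m.unop
      map_id := fun L => map_id L.unop
      map_comp := fun m m' => map_comp _ _ _ m'.unop m.unop },
    fun _ => rfl, fun _ _ _ => HEq.rfl⟩
end

section
/- There is a passage (functor) from databases to lax sound logics: the assignment sending each FOLE relational database R with constant type domain to its associated lax sound logic and each database morphism (𝐑, κ, φ̀, f, g) : R₂ ← R₁ to the associated lax sound logic morphism (𝐑, κ, φ̀, f, g) : L₂ ⇌ L₁ (with the same components) preserves identities and composition, and hence defines a functor snd̊ : Db^op → Snd̊ from the opposite of the category of FOLE relational databases with constant type domains to the category of lax sound logics. -/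
open CategoryTheory Opposite

/-! ## Statement 2: the passage (functor) from databases to lax sound logics -/

/-- The passage from databases to lax sound logics, as a functor on the opposite category. -/
def sndFunctor : BDatabaseᵒᵖ ⥤ BSoundLogic where
  obj D := sndOf D.unop
  map m := sndDataOf m.unop
  map_id _ := rfl
  map_comp _ _ := rfl

theorem database_to_sound_logic_passage :
    -- the assignment preserves identities ...
    (∀ D : BDatabase, sndDataOf (𝟙 D) = 𝟙 (sndOf D)) ∧
    -- ... and composition ...
    (∀ (D D' D'' : BDatabase) (m : D ⟶ D') (m' : D' ⟶ D''),
      sndDataOf (m ≫ m') = sndDataOf m' ≫ sndDataOf m) ∧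
    -- ... and hence defines a functor `snd̊ : Dbᵒᵖ ⥤ Snd̊` sending each
    -- database to its associated lax sound logic and each database morphism
    -- to the associated lax sound logic morphism with the same components
    (∃ F : BDatabaseᵒᵖ ⥤ BSoundLogic,
      (∀ D : BDatabase, F.obj (Opposite.op D) = sndOf D) ∧
      (∀ (D D' : BDatabase) (m : D ⟶ D'), HEq (F.map m.op) (sndDataOf m))) := by
  exact ⟨fun _ => rfl, fun _ _ _ _ _ => rfl, sndFunctor, fun _ => rfl, fun _ _ _ => HEq.rfl⟩
end

section
/- Key Proposition (satisfaction is equivalent to tabular interpretation): Let S = (R, σ, X) be a schema, M a lax S-structure with type domain A, and T = (𝐑, 𝐒, X) an abstract S-specification. Then the following are equivalent: (i) M satisfies T; (ii) there exists a functor 𝐓 : 𝐑^op → Rel(A) with 𝐓(r) = R_M(r) for every predicate r, such that for every abstract constraint p : r' → r the relation morphism 𝐓(p) : R_M(r') ← R_M(r) is given by the signature morphism 𝐒(p); (iii) there exists a family of key functions (k_p), indexed by the abstract constraints, such that for each p : r' → r the pair (𝐒(p), k_p) : T_M(r') ← T_M(r) is a table morphism in Tbl(A). -/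
open CategoryTheory Opposite

/-! ## Statement 3 (Key Proposition): satisfaction is equivalent to tabular
interpretation -/

/-- The functor into relations determined by a structure satisfying a specification. -/
def relationFunctor {X : Type} {S : Schema X} [Category.{0} S.Pred] {A : TypeDomain X}
    (M : LaxStructure S A) (T : AbstractSpec S) (h : Satisfies M T) :
    S.Predᵒᵖ ⥤ Relation A where
  obj r := M.relInterp r.unop
  map p := RelMor.mk (T.smor p.unop) fun _ ht => h p.unop (Set.mem_image_of_mem _ ht)
  map_id r := RelMor.ext' (T.smor_id r.unop)
  map_comp p q := RelMor.ext' (T.smor_comp q.unop p.unop)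

/-- A relation morphism, transported along equalities of its source and target, still maps
the source relation into the target relation. -/
theorem RelMor.tupMap_mem_of_heq {X : Type} {A : TypeDomain X} {R R' Q Q' : Relation A}
    (m : RelMor A R R') (hR : R = Q) (hR' : R' = Q') {h : SigMor Q'.sig Q.sig}
    (hm : HEq m.sigMor h) {t : tup A Q.sig} (ht : t ∈ Q.rel) :
    tupMap A h t ∈ Q'.rel := by
  subst hR hR'
  obtain rfl := eq_of_heq hm
  exact m.cond t ht

theorem satisfaction_equiv_tabular_interpretation {X : Type} (S : Schema X)
    [Category.{0} S.Pred] (A : TypeDomain X) (M : LaxStructure S A)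
    (T : AbstractSpec S) :
    -- (i) ↔ (ii): satisfaction is equivalent to the existence of a functor
    -- `𝐓 : 𝐑ᵒᵖ ⥤ Rel(A)` whose value at each predicate is the relation
    -- interpretation and whose value at each abstract constraint is the
    -- relation morphism given by the signature morphism `𝐒(p)`
    ((Satisfies M T) ↔
      ∃ F : S.Predᵒᵖ ⥤ Relation A,
        (∀ r : S.Pred, F.obj (Opposite.op r) = M.relInterp r) ∧
        (∀ (r' r : S.Pred) (p : r' ⟶ r),
          HEq (RelMor.sigMor (F.map p.op)) (T.smor p))) ∧
    -- (i) ↔ (iii): satisfaction is equivalent to the existence of a family of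
    -- key functions making each `(𝐒(p), k_p) : T_M(r') ← T_M(r)` a table
    -- morphism
    ((Satisfies M T) ↔
      ∃ k : ∀ (r' r : S.Pred), (r' ⟶ r) → (M.Key r → M.Key r'),
        ∀ (r' r : S.Pred) (p : r' ⟶ r) (x : M.Key r),
          M.tuple r' (k r' r p x) = tupMap A (T.smor p) (M.tuple r x)) := by
  refine ⟨⟨fun h => ⟨relationFunctor M T h, fun _ => rfl, fun _ _ _ => HEq.rfl⟩, ?_⟩, ?_, ?_⟩
  · rintro ⟨F, hobj, hmap⟩ r' r p _ ⟨t, ht, rfl⟩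
    exact RelMor.tupMap_mem_of_heq (F.map p.op) (hobj r) (hobj r') (hmap r' r p) ht
  · intro h
    choose k hk using fun (r' r : S.Pred) (p : r' ⟶ r) (x : M.Key r) =>
      h p (Set.mem_image_of_mem _ (Set.mem_range_self x))
    exact ⟨k, hk⟩
  · rintro ⟨k, hk⟩ r' r p _ ⟨_, ⟨x, rfl⟩, rfl⟩
    exact ⟨k r' r p x, hk r' r p x⟩
end

section
/- Every lax FOLE sound logic defines a FOLE relational database: Let L = (S, M, T) be a lax sound logic with type domain A and abstract specification T = (𝐑, 𝐒, X). Then there is a unique functor 𝐓 : 𝐑^op → Rel(A) sending each predicate r to the relation interpretation R_M(r) and each abstract constraint p : r' → r to the relation morphism R_M(r') ← R_M(r) given by the signature morphism 𝐒(p); composing with the inclusion of Rel(A) into Tbl(A), the triple (𝐑, 𝐓, A) is a FOLE relational database with constant type domain. -/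
open CategoryTheory Opposite

/-! ## Statement 4: every lax FOLE sound logic defines a FOLE relational
database -/

/-- The inclusion of `Rel(A)` into `Tbl(A)`, viewing each relation as the
table whose key set is the relation and whose tuple function is the
subset inclusion. -/
def relInclusion {X : Type} (A : TypeDomain X) : Relation A ⥤ Table A where
  obj R := R.toTable
  map {R R'} m := ⟨m.sigMor, fun t => ⟨tupMap A m.sigMor t.1, m.cond t.1 t.2⟩,
    fun _ => rfl⟩
  map_id := by intros; rfl
  map_comp := by intros; rfl

/-- Relation morphisms between equal relations agree when their signature morphisms do. -/
theorem RelMor.hext {X : Type} {A : TypeDomain X} {R₁ R₂ R₁' R₂' : Relation A}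
    (h : R₁ = R₂) (h' : R₁' = R₂') {m₁ : RelMor A R₁ R₁'} {m₂ : RelMor A R₂ R₂'}
    (hm : HEq m₁.sigMor m₂.sigMor) : HEq m₁ m₂ := by
  subst h h'
  exact heq_of_eq (RelMor.ext' (eq_of_heq hm))

/-- The functor `𝐑ᵒᵖ ⥤ Rel(A)` of relation interpretations defined by a lax sound logic. -/
def relInterpFunctor {X : Type} {S : Schema X} [Category.{0} S.Pred] {A : TypeDomain X}
    (M : LaxStructure S A) (T : AbstractSpec S) (sat : Satisfies M T) :
    S.Predᵒᵖ ⥤ Relation A where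
  obj r := M.relInterp r.unop
  map p := ⟨T.smor p.unop, fun t ht => sat p.unop ⟨t, ht, rfl⟩⟩
  map_id r := RelMor.ext' (T.smor_id r.unop)
  map_comp p q := RelMor.ext' (T.smor_comp q.unop p.unop)

theorem sound_logic_defines_database {X : Type} (S : Schema X)
    [Category.{0} S.Pred] (A : TypeDomain X) (M : LaxStructure S A)
    (T : AbstractSpec S) (sat : Satisfies M T) :
    -- there is a unique functor `𝐓 : 𝐑ᵒᵖ ⥤ Rel(A)` sending each predicate to
    -- its relation interpretation and each abstract constraint `p` to the
    -- relation morphism given by the signature morphism `𝐒(p)` ...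
    (∃! F : S.Predᵒᵖ ⥤ Relation A,
      (∀ r : S.Pred, F.obj (Opposite.op r) = M.relInterp r) ∧
      (∀ (r' r : S.Pred) (p : r' ⟶ r),
        HEq (RelMor.sigMor (F.map p.op)) (T.smor p))) ∧
    -- ... and, composing with the inclusion of `Rel(A)` into `Tbl(A)`, the
    -- triple `(𝐑, 𝐓, A)` is a FOLE relational database with constant type
    -- domain, i.e. there is a table interpretation functor `𝐑ᵒᵖ ⥤ Tbl(A)`
    (∀ F : S.Predᵒᵖ ⥤ Relation A,
      ((∀ r : S.Pred, F.obj (Opposite.op r) = M.relInterp r) ∧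
       (∀ (r' r : S.Pred) (p : r' ⟶ r),
         HEq (RelMor.sigMor (F.map p.op)) (T.smor p))) →
      ∃ D : S.Predᵒᵖ ⥤ Table A, D = F ⋙ relInclusion A) := by
  refine ⟨⟨relInterpFunctor M T sat, ⟨fun _ => rfl, fun _ _ _ => HEq.rfl⟩, ?_⟩,
    fun F _ => ⟨F ⋙ relInclusion A, rfl⟩⟩
  rintro F ⟨hobj, hmap⟩
  exact CategoryTheory.Functor.hext (fun r => hobj r.unop) fun r r' p =>
    RelMor.hext (hobj r.unop) (hobj r'.unop) (hmap r'.unop r.unop p.unop)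
end

section
/- Every FOLE relational database defines a lax sound logic: Let R = (𝐑, 𝐓, A) be a FOLE relational database with constant type domain, with signature functor 𝐒 and tables 𝐓(r) = (𝐒(r), 𝐊(r), τ_r). Let S be the schema whose predicate set is the object set of 𝐑 with σ(r) = 𝐒(r), let M be the lax S-structure with key sets 𝐊(r) and tuple functions τ_r, and let T = (𝐑, 𝐒, X) be the abstract S-specification. Then M satisfies T — that is, for every abstract constraint p : r' → r of 𝐑, the direct image of τ_r(𝐊(r)) under tup_A(𝐒(p)) is contained in τ_{r'}(𝐊(r')) — and hence (S, M, T) is a lax sound logic. -/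
open CategoryTheory Opposite

/-! ## Statement 5: every FOLE relational database defines a lax sound logic -/

/-- The schema underlying a database: predicate set the objects of `𝐑`, with
`σ(r) = 𝐒(r)` the signature of the table `𝐓(r)`. -/
abbrev dbSchema {X : Type} {A : TypeDomain X} {P : Type} [Category.{0} P]
    (Tf : Pᵒᵖ ⥤ Table A) : Schema X :=
  ⟨P, fun r => (Tf.obj (Opposite.op r)).sig⟩

/-- The lax structure underlying a database: key sets and tuple functions those
of the tables `𝐓(r)`. -/
abbrev dbStructure {X : Type} {A : TypeDomain X} {P : Type} [Category.{0} P]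
    (Tf : Pᵒᵖ ⥤ Table A) : LaxStructure (dbSchema Tf) A :=
  ⟨fun r => (Tf.obj (Opposite.op r)).Key, fun r => (Tf.obj (Opposite.op r)).tuple⟩

theorem TableMor.image_range_tuple_subset {X : Type} {A : TypeDomain X} {T T' : Table A}
    (m : TableMor A T T') :
    tupMap A m.sigMor '' Set.range T.tuple ⊆ Set.range T'.tuple := by
  rintro _ ⟨_, ⟨k, rfl⟩, rfl⟩
  exact ⟨m.keyFun k, m.cond k⟩

/-- The abstract specification given by the signature functor of a database. -/
def dbSpec {X : Type} {A : TypeDomain X} {P : Type} [Category.{0} P]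
    (Tf : Pᵒᵖ ⥤ Table A) : AbstractSpec (dbSchema Tf) where
  smor p := TableMor.sigMor (Tf.map (Quiver.Hom.op (V := P) p))
  smor_id r := congrArg TableMor.sigMor (Tf.map_id (Opposite.op (α := P) r))
  smor_comp p q := congrArg TableMor.sigMor
    (Tf.map_comp (Quiver.Hom.op (V := P) q) (Quiver.Hom.op (V := P) p))

theorem database_defines_sound_logic {X : Type} (A : TypeDomain X)
    (P : Type) [Category.{0} P] (Tf : Pᵒᵖ ⥤ Table A) :
    -- the structure satisfies every abstract constraint: the direct image of
    -- `τ_r(𝐊(r))` under `tup_A(𝐒(p))` is contained in `τ_{r'}(𝐊(r'))`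
    (∀ (r' r : P) (p : r' ⟶ r),
      tupMap A (TableMor.sigMor (Tf.map p.op)) ''
          Set.range ((Tf.obj (Opposite.op r)).tuple)
        ⊆ Set.range ((Tf.obj (Opposite.op r')).tuple)) ∧
    -- hence `(S, M, T)` is a lax sound logic: the specification `(𝐑, 𝐒, X)`
    -- is satisfied by the underlying lax structure
    (∃ Spec : AbstractSpec (dbSchema Tf),
      (∀ (r' r : P) (p : r' ⟶ r), Spec.smor p = TableMor.sigMor (Tf.map p.op)) ∧
      Satisfies (dbStructure Tf) Spec) := by
  have h (r' r : P) (p : r' ⟶ r) := TableMor.image_range_tuple_subset (Tf.map p.op)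
  exact ⟨h, dbSpec Tf, fun _ _ _ => rfl, fun {r' r} p => h r' r p⟩
end

section
/- Sound logic morphisms preserve and link satisfaction (naturality up to key equivalence): Let (𝐑, κ, φ̀, f, g) : L₂ ⇌ L₁ be a lax sound logic morphism. Let p₂ : r'₂ → r₂ be an abstract constraint of 𝐑₂ with image p₁ = 𝐑(p₂) : r'₁ → r₁ in 𝐑₁ (so r'₁ = 𝐑(r'₂) and r₁ = 𝐑(r₂)), and write h₂ = 𝐒₂(p₂) and h₁ = 𝐒₁(p₁). Let k_{p₂} : K₂(r₂) → K₂(r'₂) and k_{p₁} : K₁(r₁) → K₁(r'₁) be key functions witnessing satisfaction, i.e., τ₂,r'₂ ∘ k_{p₂} = tup_{A₂}(h₂) ∘ τ₂,r₂ and τ₁,r'₁ ∘ k_{p₁} = tup_{A₁}(h₁) ∘ τ₁,r₁. Then the naturality square commutes up to key equivalence: τ₂,r'₂ ∘ κ_{r'₂} ∘ k_{p₁} = τ₂,r'₂ ∘ k_{p₂} ∘ κ_{r₂} as functions K₁(r₁) → tup_{A₂}(σ₂(r'₂)). Consequently, on relation interpretations the corresponding square commutes exactly: for every tuple t ∈ τ₁(K₁(r₁)),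 g ∘ (t ∘ h₁) ∘ φ̀_{r'₂} = (g ∘ t ∘ φ̀_{r₂}) ∘ h₂. -/
open CategoryTheory Opposite

/-- A lax sound logic morphism `(𝐑, κ, φ̀, f, g) : L₂ ⇌ L₁` between lax sound
logics: a lax structure morphism and an abstract specification morphism along a
common schema morphism (the functor `𝐑` agrees with the predicate function on
objects, and `φ̀`, `f`, `g` are shared). -/
structure SoundLogicMor {X₂ X₁ : Type} {S₂ : Schema X₂} {S₁ : Schema X₁}
    [Category.{0} S₂.Pred] [Category.{0} S₁.Pred]
    {A₂ : TypeDomain X₂} {A₁ : TypeDomain X₁}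
    (M₂ : LaxStructure S₂ A₂) (M₁ : LaxStructure S₁ A₁)
    (T₂ : AbstractSpec S₂) (T₁ : AbstractSpec S₁) : Type 1 where
  RFun : S₂.Pred ⥤ S₁.Pred
  f : X₂ → X₁
  g : A₁.Value → A₂.Value
  info : ∀ y x, A₂.classify (g y) x ↔ A₁.classify y (f x)
  φ : ∀ r₂ : S₂.Pred, SigMor (sigSigma f (S₂.sigOf r₂)) (S₁.sigOf (RFun.obj r₂))
  φ_nat : ∀ {r'₂ r₂ : S₂.Pred} (p : r'₂ ⟶ r₂),
    (φ r₂).toFun ∘ (T₂.smor p).toFun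
      = (T₁.smor (RFun.map p)).toFun ∘ (φ r'₂).toFun
  κ : ∀ r₂ : S₂.Pred, M₁.Key (RFun.obj r₂) → M₂.Key r₂
  tuple_cond : ∀ (r₂ : S₂.Pred) (k₁ : M₁.Key (RFun.obj r₂)),
    M₂.tuple r₂ (κ r₂ k₁)
      = tupConv A₂ A₁ f g info (S₂.sigOf r₂)
          (tupMap A₁ (φ r₂) (M₁.tuple (RFun.obj r₂) k₁))

/-! ## Statement 6: sound logic morphisms preserve and link satisfaction
(naturality up to key equivalence) -/

/-- Tuple conversion along a sound logic morphism is natural in abstract constraints. -/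
theorem SoundLogicMor.tupConv_naturality
    {X₂ X₁ : Type} {S₂ : Schema X₂} {S₁ : Schema X₁}
    [Category.{0} S₂.Pred] [Category.{0} S₁.Pred]
    {A₂ : TypeDomain X₂} {A₁ : TypeDomain X₁}
    {M₂ : LaxStructure S₂ A₂} {M₁ : LaxStructure S₁ A₁}
    {T₂ : AbstractSpec S₂} {T₁ : AbstractSpec S₁}
    (m : SoundLogicMor M₂ M₁ T₂ T₁) {r'₂ r₂ : S₂.Pred} (p₂ : r'₂ ⟶ r₂)
    (t : tup A₁ (S₁.sigOf (m.RFun.obj r₂))) :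
    tupConv A₂ A₁ m.f m.g m.info (S₂.sigOf r'₂)
        (tupMap A₁ (m.φ r'₂) (tupMap A₁ (T₁.smor (m.RFun.map p₂)) t))
      = tupMap A₂ (T₂.smor p₂)
          (tupConv A₂ A₁ m.f m.g m.info (S₂.sigOf r₂) (tupMap A₁ (m.φ r₂) t)) :=
  Subtype.ext <| funext fun i =>
    congrArg (fun j => m.g (t.1 j)) (congrFun (m.φ_nat p₂) i).symm

theorem sound_logic_morphism_preserves_satisfaction
    {X₂ X₁ : Type} {S₂ : Schema X₂} {S₁ : Schema X₁}
    [Category.{0} S₂.Pred] [Category.{0} S₁.Pred]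
    {A₂ : TypeDomain X₂} {A₁ : TypeDomain X₁}
    {M₂ : LaxStructure S₂ A₂} {M₁ : LaxStructure S₁ A₁}
    {T₂ : AbstractSpec S₂} {T₁ : AbstractSpec S₁}
    (sat₂ : Satisfies M₂ T₂) (sat₁ : Satisfies M₁ T₁)
    (m : SoundLogicMor M₂ M₁ T₂ T₁)
    -- an abstract constraint of `𝐑₂` with image `p₁ = 𝐑(p₂)`
    {r'₂ r₂ : S₂.Pred} (p₂ : r'₂ ⟶ r₂)
    -- key functions witnessing satisfaction at source and target
    (kp₂ : M₂.Key r₂ → M₂.Key r'₂)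
    (hkp₂ : ∀ k, M₂.tuple r'₂ (kp₂ k) = tupMap A₂ (T₂.smor p₂) (M₂.tuple r₂ k))
    (kp₁ : M₁.Key (m.RFun.obj r₂) → M₁.Key (m.RFun.obj r'₂))
    (hkp₁ : ∀ k, M₁.tuple (m.RFun.obj r'₂) (kp₁ k)
      = tupMap A₁ (T₁.smor (m.RFun.map p₂)) (M₁.tuple (m.RFun.obj r₂) k)) :
    -- the naturality square commutes up to key equivalence
    (∀ k₁ : M₁.Key (m.RFun.obj r₂),
      M₂.tuple r'₂ (m.κ r'₂ (kp₁ k₁)) = M₂.tuple r'₂ (kp₂ (m.κ r₂ k₁))) ∧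
    -- consequently, on relation interpretations the square commutes exactly:
    -- for every tuple `t ∈ τ₁(K₁(r₁))`,
    -- `g ∘ (t ∘ h₁) ∘ φ̀_{r'₂} = (g ∘ t ∘ φ̀_{r₂}) ∘ h₂`
    (∀ t : tup A₁ (S₁.sigOf (m.RFun.obj r₂)),
      t ∈ Set.range (M₁.tuple (m.RFun.obj r₂)) →
        tupConv A₂ A₁ m.f m.g m.info (S₂.sigOf r'₂)
            (tupMap A₁ (m.φ r'₂) (tupMap A₁ (T₁.smor (m.RFun.map p₂)) t))
          = tupMap A₂ (T₂.smor p₂)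
              (tupConv A₂ A₁ m.f m.g m.info (S₂.sigOf r₂)
                (tupMap A₁ (m.φ r₂) t))) := by
  refine ⟨fun k₁ => ?_, fun t _ => m.tupConv_naturality p₂ t⟩
  rw [m.tuple_cond, hkp₁, hkp₂, m.tuple_cond]
  exact m.tupConv_naturality p₂ _
end

section
/- Every lax sound logic morphism defines a database morphism: Let (𝐑, κ, φ̀, f, g) : L₂ ⇌ L₁ be a lax sound logic morphism, and let R₂ = (𝐑₂, 𝐓₂, A₂) and R₁ = (𝐑₁, 𝐓₁, A₁) be the associated databases, where 𝐓_i : 𝐑_i^op → Rel(A_i) ⊆ Tbl(A_i) sends each predicate r to the relation interpretation R_{M_i}(r). For each predicate r₂ of 𝐑₂ define κ̄_{r₂}(t) = g ∘ t ∘ φ̀_{r₂} for tuples t. Then: (i) κ̄_{r₂} is well defined, mapping the image relation τ₁(K₁(r(r₂))) into the image relation τ₂(K₂(r₂)); (ii) the family κ̄ is a strictly natural transformation between the key functors of the associated databases; and (iii) (𝐑, κ̄, φ̀, f, g) : R₂ ← R₁ is a database morphism, i.e., it satisfies the tuple condition τ̄₂,r₂ ∘ κ̄_{r₂} = τ̀_{(f,g)}(σ₂(r₂))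 ∘ tup_{A₁}(φ̀_{r₂}) ∘ τ̄₁,r(r₂), where τ̄ denotes the inclusion tuple functions of the image-relation tables. -/
open CategoryTheory Opposite

/-! ## Statement 7: every lax sound logic morphism defines a database
morphism -/

/-- The key set of the associated database at `r`: the image relation
`τ_r(K(r))`. -/
def imgKey {X : Type} {S : Schema X} {A : TypeDomain X}
    (M : LaxStructure S A) (r : S.Pred) : Type :=
  { t : tup A (S.sigOf r) // t ∈ Set.range (M.tuple r) }

/-- The key map of the associated database at an abstract constraint `p`:
the image relations are mapped by `tup_A(𝐒(p))` (well defined by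
satisfaction). -/
def imgMap {X : Type} {S : Schema X} [Category.{0} S.Pred] {A : TypeDomain X}
    {M : LaxStructure S A} {T : AbstractSpec S} (sat : Satisfies M T)
    {r' r : S.Pred} (p : r' ⟶ r) : imgKey M r → imgKey M r' :=
  fun t => ⟨tupMap A (T.smor p) t.1, sat p ⟨t.1, t.2, rfl⟩⟩

/-- The image key bridge `κ̄` of a lax sound logic morphism, with components
`κ̄_{r₂}(t) = g ∘ t ∘ φ̀_{r₂}` on image relations. -/
noncomputable def barKappa {X₂ X₁ : Type} {S₂ : Schema X₂} {S₁ : Schema X₁}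
    [Category.{0} S₂.Pred] [Category.{0} S₁.Pred]
    {A₂ : TypeDomain X₂} {A₁ : TypeDomain X₁}
    {M₂ : LaxStructure S₂ A₂} {M₁ : LaxStructure S₁ A₁}
    {T₂ : AbstractSpec S₂} {T₁ : AbstractSpec S₁}
    (m : SoundLogicMor M₂ M₁ T₂ T₁) (r₂ : S₂.Pred) :
    imgKey M₁ (m.RFun.obj r₂) → imgKey M₂ r₂ :=
  fun t =>
    ⟨tupConv A₂ A₁ m.f m.g m.info (S₂.sigOf r₂) (tupMap A₁ (m.φ r₂) t.1),
      ⟨m.κ r₂ t.2.choose, by rw [m.tuple_cond, t.2.choose_spec]⟩⟩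

theorem sound_logic_morphism_defines_database_morphism
    {X₂ X₁ : Type} {S₂ : Schema X₂} {S₁ : Schema X₁}
    [Category.{0} S₂.Pred] [Category.{0} S₁.Pred]
    {A₂ : TypeDomain X₂} {A₁ : TypeDomain X₁}
    {M₂ : LaxStructure S₂ A₂} {M₁ : LaxStructure S₁ A₁}
    {T₂ : AbstractSpec S₂} {T₁ : AbstractSpec S₁}
    (sat₂ : Satisfies M₂ T₂) (sat₁ : Satisfies M₁ T₁)
    (m : SoundLogicMor M₂ M₁ T₂ T₁) :
    -- (i) `κ̄_{r₂}` is well defined: it maps the image relation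
    -- `τ₁(K₁(r(r₂)))` into the image relation `τ₂(K₂(r₂))`
    (∀ (r₂ : S₂.Pred) (t : tup A₁ (S₁.sigOf (m.RFun.obj r₂))),
      t ∈ Set.range (M₁.tuple (m.RFun.obj r₂)) →
        tupConv A₂ A₁ m.f m.g m.info (S₂.sigOf r₂) (tupMap A₁ (m.φ r₂) t)
          ∈ Set.range (M₂.tuple r₂)) ∧
    -- (ii) the family `κ̄` is strictly natural between the key functors of
    -- the associated databases
    (∀ (r'₂ r₂ : S₂.Pred) (p : r'₂ ⟶ r₂) (t : imgKey M₁ (m.RFun.obj r₂)),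
      barKappa m r'₂ (imgMap sat₁ (m.RFun.map p) t)
        = imgMap sat₂ p (barKappa m r₂ t)) ∧
    -- (iii) `(𝐑, κ̄, φ̀, f, g)` satisfies the tuple condition of a database
    -- morphism, where the tuple functions of the image-relation tables are
    -- the subset inclusions
    (∀ (r₂ : S₂.Pred) (t : imgKey M₁ (m.RFun.obj r₂)),
      (barKappa m r₂ t).1
        = tupConv A₂ A₁ m.f m.g m.info (S₂.sigOf r₂)
            (tupMap A₁ (m.φ r₂) t.1)) := by
  refine ⟨?_, ?_, fun _ _ => rfl⟩
  · rintro r₂ _ ⟨k, rfl⟩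
    exact ⟨m.κ r₂ k, m.tuple_cond r₂ k⟩
  · intro r'₂ r₂ p t
    refine Subtype.ext (Subtype.ext (funext fun i => ?_))
    exact congrArg (fun j => m.g (t.1.1 j)) (congrFun (m.φ_nat p) i).symm
end
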